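/- The relation <'_O is recursively enumerable (the set of pairs (a,b) with a <'_O b is the domain of a partial recursive function), and <'_O coincides with <_O on Kleene's O: for all a, b ∈ O, a <'_O b if and only if a <_O b. -/

import Mathlib

namespace Shoen

/-- Kleene application: value of the `e`-th partial recursive function at `n`,
in the standard numbering via `Nat.Partrec.Code`. -/
def peval (e n : ℕ) : Part ℕ := (Denumerable.ofNat Nat.Partrec.Code e).eval n

/-- `e` is an index of a (total) primitive recursive function. -/
def PrimIndex (e : ℕ) : Prop := ∃ f : ℕ → ℕ, Nat.Primrec f ∧ ∀ n, peval e n = Part.some (f n)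

/-- Kleene's relation `<_O`. -/
inductive KLt : ℕ → ℕ → Prop
  | base : KLt 1 2
  | step {a b : ℕ} : KLt a b → KLt b (2 ^ b)
  | lim {e : ℕ} (h : ∀ n, (peval e n).Dom)
      (hm : ∀ n, KLt ((peval e n).get (h n)) ((peval e (n + 1)).get (h (n + 1))))
      (n : ℕ) : KLt ((peval e n).get (h n)) (3 * 5 ^ e)
  | trans {a b c : ℕ} : KLt a b → KLt b c → KLt a c

/-- Kleene's `O`. -/
def KO (a : ℕ) : Prop := KLt a (2 ^ a)

/-- The auxiliary relation `<'_O`. -/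
inductive KLt' : ℕ → ℕ → Prop
  | base : KLt' 1 2
  | step {a b : ℕ} : KLt' a b → KLt' b (2 ^ b)
  | lim {e n x : ℕ} : x ∈ peval e n → KLt' x (3 * 5 ^ e)
  | trans {a b c : ℕ} : KLt' a b → KLt' b c → KLt' a c

/-- The inductive characterization `O'` of Kleene's `O`. -/
inductive KO' : ℕ → Prop
  | one : KO' 1
  | step {a : ℕ} : KO' a → KO' (2 ^ a)
  | lim {e : ℕ} (h : ∀ n, (peval e n).Dom)
      (hm : ∀ n, KLt' ((peval e n).get (h n)) ((peval e (n + 1)).get (h (n + 1)))) :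
      KO' (3 * 5 ^ e)

/-- The instance of the limit clause of `<'_O` coded by `k = ⟨e, n, m⟩`: the value at `n` of the
`e`-th function, provided the computation converges within `m` steps. -/
def limPair (k : ℕ) : Option (ℕ × ℕ) :=
  let t := Denumerable.ofNat (ℕ × ℕ × ℕ) k
  (Nat.Partrec.Code.evaln t.2.2 (Denumerable.ofNat Nat.Partrec.Code t.1) t.2.1).map
    fun x => (x, 3 * 5 ^ t.1)

/-- Composable pairs give their composite. -/
def compPair (p q : ℕ × ℕ) : Option (ℕ × ℕ) :=
  if p.2 = q.1 then some (p.1, q.2) else none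

/-- One round of closing a list of pairs under the clauses defining `<'_O`. -/
def closeStep (k : ℕ) (l : List (ℕ × ℕ)) : List (ℕ × ℕ) :=
  l ++ (l.map (fun p => (p.2, 2 ^ p.2)) ++
    ((limPair k).toList ++ l.flatMap fun p => l.filterMap (compPair p)))

/-- The pairs enumerated into `<'_O` by stage `k`. -/
def stage (k : ℕ) : List (ℕ × ℕ) :=
  Nat.rec [(1, 2)] closeStep k

theorem primrec_pow : Primrec₂ ((· ^ ·) : ℕ → ℕ → ℕ) :=
  Primrec₂.unpaired'.1 Nat.Primrec.pow

theorem primrec_limPair : Primrec limPair := by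
  have ht : Primrec (Denumerable.ofNat (ℕ × ℕ × ℕ)) := Primrec.ofNat _
  have he := Primrec.fst.comp ht
  refine Primrec.option_map (Nat.Partrec.Code.primrec_evaln.comp (Primrec.pair (Primrec.pair
    (Primrec.snd.comp (Primrec.snd.comp ht)) ((Primrec.ofNat _).comp he))
    (Primrec.fst.comp (Primrec.snd.comp ht)))) ?_
  exact (Primrec.pair Primrec.snd (Primrec.nat_mul.comp (Primrec.const 3)
    (primrec_pow.comp (Primrec.const 5) (he.comp Primrec.fst)))).to₂

theorem primrec_compPair : Primrec₂ compPair :=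
  (Primrec.ite (Primrec.eq.comp (Primrec.snd.comp Primrec.fst) (Primrec.fst.comp Primrec.snd))
    (Primrec.option_some.comp (Primrec.pair (Primrec.fst.comp Primrec.fst)
      (Primrec.snd.comp Primrec.snd))) (Primrec.const none)).to₂

theorem primrec_closeStep : Primrec₂ closeStep := by
  refine Primrec.list_append.comp₂ Primrec₂.right (Primrec.list_append.comp₂ ?_
    (Primrec.list_append.comp₂ ?_ ?_))
  · exact Primrec.list_map Primrec.snd (Primrec.pair (Primrec.snd.comp Primrec.snd)
      (primrec_pow.comp (Primrec.const 2) (Primrec.snd.comp Primrec.snd))).to₂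
  · exact (Primrec.optionToList.comp primrec_limPair).comp₂ Primrec₂.left
  · exact Primrec.list_flatMap Primrec.snd (Primrec.listFilterMap (Primrec.snd.comp Primrec.fst)
      (primrec_compPair.comp₂ (Primrec.snd.comp₂ Primrec₂.left) Primrec₂.right)).to₂

theorem primrec_stage : Primrec stage :=
  Primrec.nat_rec₁ _ primrec_closeStep

theorem mem_closeStep {k : ℕ} {l : List (ℕ × ℕ)} {r : ℕ × ℕ} :
    r ∈ closeStep k l ↔ r ∈ l ∨ (∃ p ∈ l, (p.2, 2 ^ p.2) = r) ∨ r ∈ limPair k ∨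
      ∃ p ∈ l, ∃ q ∈ l, p.2 = q.1 ∧ (p.1, q.2) = r := by
  simp only [closeStep, compPair, List.mem_append, List.mem_map, List.mem_flatMap,
    List.mem_filterMap, Option.mem_toList, Option.mem_def, Option.ite_none_right_eq_some,
    Option.some.injEq]

theorem mem_stage_succ {k : ℕ} {r : ℕ × ℕ} :
    r ∈ stage (k + 1) ↔ r ∈ stage k ∨ (∃ p ∈ stage k, (p.2, 2 ^ p.2) = r) ∨ r ∈ limPair k ∨
      ∃ p ∈ stage k, ∃ q ∈ stage k, p.2 = q.1 ∧ (p.1, q.2) = r :=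
  mem_closeStep

theorem stage_subset {k m : ℕ} (h : k ≤ m) {r : ℕ × ℕ} (hr : r ∈ stage k) : r ∈ stage m := by
  induction h with
  | refl => exact hr
  | step _ ih => exact mem_stage_succ.2 (Or.inl ih)

theorem KLt'.of_mem_limPair {k : ℕ} {r : ℕ × ℕ} (h : r ∈ limPair k) : KLt' r.1 r.2 := by
  obtain ⟨x, hx, rfl⟩ := Option.mem_map.1 h
  exact KLt'.lim (Nat.Partrec.Code.evaln_sound hx)

theorem exists_mem_limPair {e n x : ℕ} (h : x ∈ peval e n) : ∃ k, (x, 3 * 5 ^ e) ∈ limPair k := by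
  obtain ⟨m, hm⟩ := Nat.Partrec.Code.evaln_complete.1 h
  refine ⟨Encodable.encode (e, n, m), ?_⟩
  simp only [limPair, Denumerable.ofNat_encode]
  exact Option.mem_map.2 ⟨x, hm, rfl⟩

theorem KLt'.of_mem_stage {k : ℕ} {r : ℕ × ℕ} (h : r ∈ stage k) : KLt' r.1 r.2 := by
  induction k generalizing r with
  | zero =>
    obtain rfl : r = (1, 2) := List.mem_singleton.1 h
    exact KLt'.base
  | succ k ih =>
    rcases mem_stage_succ.1 h with h | ⟨p, hp, rfl⟩ | h | ⟨p, hp, q, hq, hpq, rfl⟩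
    · exact ih h
    · exact KLt'.step (ih hp)
    · exact KLt'.of_mem_limPair h
    · exact (ih hp).trans (hpq ▸ ih hq)

theorem KLt'.exists_mem_stage {a b : ℕ} (h : KLt' a b) : ∃ k, (a, b) ∈ stage k := by
  induction h with
  | base => exact ⟨0, List.mem_singleton.2 rfl⟩
  | step _ ih =>
    obtain ⟨k, hk⟩ := ih
    exact ⟨k + 1, mem_stage_succ.2 (Or.inr (Or.inl ⟨_, hk, rfl⟩))⟩
  | lim hx =>
    obtain ⟨k, hk⟩ := exists_mem_limPair hx
    exact ⟨k + 1, mem_stage_succ.2 (Or.inr (Or.inr (Or.inl hk)))⟩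
  | trans _ _ ih₁ ih₂ =>
    obtain ⟨k, hk⟩ := ih₁
    obtain ⟨m, hm⟩ := ih₂
    exact ⟨max k m + 1, mem_stage_succ.2 (Or.inr (Or.inr (Or.inr
      ⟨_, stage_subset (le_max_left k m) hk, _, stage_subset (le_max_right k m) hm, rfl, rfl⟩)))⟩

theorem kltPrime_iff_exists_mem_stage {a b : ℕ} : KLt' a b ↔ ∃ k, (a, b) ∈ stage k :=
  ⟨KLt'.exists_mem_stage, fun ⟨_, h⟩ => KLt'.of_mem_stage h⟩

theorem primrecRel_mem_stage : PrimrecRel fun n k : ℕ => n.unpair ∈ stage k :=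
  ((Primrec.eq (α := ℕ × ℕ)).exists_mem_list.comp (primrec_stage.comp Primrec.snd)
    (Primrec.unpair.comp Primrec.fst)).of_eq fun _ => by simp

theorem kltPrime_re :
    ∃ φ : ℕ →. ℕ, Nat.Partrec φ ∧ ∀ a b : ℕ, (KLt' a b ↔ (φ (Nat.pair a b)).Dom) := by
  refine ⟨fun n => Nat.rfind fun k => Part.some (decide (n.unpair ∈ stage k)), ?_, fun a b => ?_⟩
  · exact Partrec.nat_iff.1 (Partrec.rfind primrecRel_mem_stage.decide.to_comp.partrec)
  · refine kltPrime_iff_exists_mem_stage.trans (Iff.trans ?_ Nat.rfind_dom.symm)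
    simp

theorem KLt.toKLt' {a b : ℕ} (h : KLt a b) : KLt' a b := by
  induction h with
  | base => exact KLt'.base
  | step _ ih => exact KLt'.step ih
  | lim h _ n _ => exact KLt'.lim (Part.get_mem (h n))
  | trans _ _ ih₁ ih₂ => exact KLt'.trans ih₁ ih₂

/-- The members of Kleene's `O`, generated directly; limits carry membership for all terms of their
fundamental sequence. -/
inductive IsOrdinalCode : ℕ → Prop
  | one : IsOrdinalCode 1
  | succ {a : ℕ} : IsOrdinalCode a → IsOrdinalCode (2 ^ a)
  | lim {e : ℕ} (h : ∀ n, (peval e n).Dom)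
      (hm : ∀ n, KLt ((peval e n).get (h n)) ((peval e (n + 1)).get (h (n + 1))))
      (ho : ∀ n, IsOrdinalCode ((peval e n).get (h n))) : IsOrdinalCode (3 * 5 ^ e)

theorem KLt.isOrdinalCode {a b : ℕ} (h : KLt a b) : IsOrdinalCode a ∧ IsOrdinalCode b := by
  induction h with
  | base => exact ⟨IsOrdinalCode.one, IsOrdinalCode.succ IsOrdinalCode.one⟩
  | step _ ih => exact ⟨ih.2, IsOrdinalCode.succ ih.2⟩
  | lim h hm n ih => exact ⟨(ih n).1, IsOrdinalCode.lim h hm fun m => (ih m).1⟩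
  | trans _ _ ih₁ ih₂ => exact ⟨ih₁.1, ih₂.2⟩

theorem IsOrdinalCode.klt_two_pow {a : ℕ} (h : IsOrdinalCode a) : KLt a (2 ^ a) := by
  induction h with
  | one => exact KLt.base
  | succ _ ih => exact KLt.step ih
  | lim h hm _ _ => exact KLt.step (KLt.lim h hm 0)

theorem two_pow_ne_three_mul (c m : ℕ) : 2 ^ c ≠ 3 * m := fun h =>
  absurd (Nat.prime_three.dvd_of_dvd_pow (Dvd.intro m h.symm)) (by decide)

theorem KLt'.ne_zero {a b : ℕ} (h : KLt' a b) : b ≠ 0 := by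
  induction h with
  | base => exact two_ne_zero
  | step => positivity
  | lim => positivity
  | trans _ _ _ ih => exact ih

theorem KLt'.cases_right {a b : ℕ} (h : KLt' a b) :
    (∃ c, c ≠ 0 ∧ b = 2 ^ c ∧ (a = c ∨ KLt' a c)) ∨
      ∃ e n x, x ∈ peval e n ∧ b = 3 * 5 ^ e ∧ (a = x ∨ KLt' a x) := by
  induction h with
  | base => exact Or.inl ⟨1, one_ne_zero, rfl, Or.inl rfl⟩
  | step h _ => exact Or.inl ⟨_, h.ne_zero, rfl, Or.inl rfl⟩
  | lim hx => exact Or.inr ⟨_, _, _, hx, rfl, Or.inl rfl⟩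
  | trans hab _ _ ih =>
    rcases ih with ⟨c, hc, rfl, h⟩ | ⟨e, n, x, hx, rfl, h⟩
    · exact Or.inl ⟨c, hc, rfl, Or.inr (h.elim (fun h => h ▸ hab) hab.trans)⟩
    · exact Or.inr ⟨e, n, x, hx, rfl, Or.inr (h.elim (fun h => h ▸ hab) hab.trans)⟩

theorem not_kltPrime_one {a : ℕ} : ¬ KLt' a 1 := fun h => by
  rcases h.cases_right with ⟨c, hc, h, _⟩ | ⟨e, _, _, _, h, _⟩
  · exact hc (Nat.pow_right_injective le_rfl h.symm)
  · exact two_pow_ne_three_mul 0 _ h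

theorem kltPrime_two_pow {a c : ℕ} (h : KLt' a (2 ^ c)) : a = c ∨ KLt' a c := by
  rcases h.cases_right with ⟨d, _, hd, h⟩ | ⟨e, _, _, _, h, _⟩
  · obtain rfl : c = d := Nat.pow_right_injective le_rfl hd
    exact h
  · exact (two_pow_ne_three_mul c _ h).elim

theorem kltPrime_lim {a e : ℕ} (h : KLt' a (3 * 5 ^ e)) :
    ∃ n, ∃ x ∈ peval e n, a = x ∨ KLt' a x := by
  rcases h.cases_right with ⟨d, _, hd, _⟩ | ⟨f, n, x, hx, he, h⟩
  · exact (two_pow_ne_three_mul d _ hd.symm).elim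
  · obtain rfl : e = f :=
      Nat.pow_right_injective (by decide : 2 ≤ 5) (Nat.eq_of_mul_eq_mul_left three_pos he)
    exact ⟨n, x, hx, h⟩

theorem IsOrdinalCode.klt_of_kltPrime {b : ℕ} (hb : IsOrdinalCode b) :
    ∀ {a : ℕ}, KLt' a b → KLt a b := by
  induction hb with
  | one => exact fun h => (not_kltPrime_one h).elim
  | succ hc ih =>
    intro a h
    rcases kltPrime_two_pow h with rfl | h
    · exact hc.klt_two_pow
    · exact (ih h).trans hc.klt_two_pow
  | lim hd hm _ ih =>
    intro a h
    obtain ⟨n, x, hx, h⟩ := kltPrime_lim h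
    obtain rfl := Part.get_eq_of_mem hx (hd n)
    rcases h with rfl | h
    · exact KLt.lim hd hm n
    · exact (ih n h).trans (KLt.lim hd hm n)

/-- The relation `<'_O` is recursively enumerable (the set of pairs `(a,b)` with
`a <'_O b` is the domain of a partial recursive function), and `<'_O` coincides
with `<_O` on Kleene's `O`. -/
theorem kltPrime_re_and_coincides :
    (∃ φ : ℕ →. ℕ, Nat.Partrec φ ∧ ∀ a b : ℕ, (KLt' a b ↔ (φ (Nat.pair a b)).Dom)) ∧
    (∀ a b : ℕ, KO a → KO b → (KLt' a b ↔ KLt a b)) :=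
  ⟨kltPrime_re, fun _ _ _ hb => ⟨KLt.isOrdinalCode hb |>.1.klt_of_kltPrime, KLt.toKLt'⟩⟩

end Shoen
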